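/- Let σ : 𝕋 → ℝ be continuous with 0 < σ_min := inf_{x∈𝕋} σ(x) and σ_max := sup_{x∈𝕋} σ(x) < ∞, and let u₁, u₂, u₃ be a real-valued classical solution of the 3-velocity Goldstein–Taylor system ∂ₜu₁ + √(2/3) ∂ₓu₂ = 0, ∂ₜu₂ + √(2/3) ∂ₓu₁ + (1/√3) ∂ₓu₃ = −σ(x)u₂, ∂ₜu₃ + (1/√3) ∂ₓu₂ = −σ(x)u₃ on 𝕋 × (0,∞), with initial data u₁,₀, u₂,₀, u₃,₀; set u∞ := (u₁,₀)_avg. Suppose θ > 0 and α > 0 satisfy √(2/3)·θ + α < 2σ_min, α ≤ √(2/3)·θ, and θ²σ_max²/(8σ_min − 4√(2/3)·θ − 4α) + θ²/(12(2σ_min − α)) ≤ √(2/3)·θ − α. Then for all t ≥ 0: 𝔈_θ(u₁(·,t) − u∞, u₂(·,t), u₃(·,t)) ≤ 𝔈_θ(u₁,₀ − u∞, u₂,₀, u₃,₀) · e^{−αt}. -/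

import Mathlib

open MeasureTheory Real

/-- Average of a (2π-periodic) function over one period. -/
noncomputable def havg (h : ℝ → ℝ) : ℝ := (1 / (2 * π)) * ∫ x in (0:ℝ)..(2 * π), h x

/-- Squared L²(𝕋) norm (normalized). -/
noncomputable def nsq (h : ℝ → ℝ) : ℝ := (1 / (2 * π)) * ∫ x in (0:ℝ)..(2 * π), (h x) ^ 2

/-- The anti-derivative ∂ₓ⁻¹ f with zero average. -/
noncomputable def antider (f : ℝ → ℝ) : ℝ → ℝ := fun x =>
  (∫ y in (0:ℝ)..x, f y) - havg (fun z => ∫ y in (0:ℝ)..z, f y)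

/-- The entropy functional E_θ(f,g). -/
noncomputable def entropyE (θ : ℝ) (f g : ℝ → ℝ) : ℝ :=
  nsq f + nsq g - (θ / (2 * π)) * ∫ x in (0:ℝ)..(2 * π), antider f x * g x

/-- The three-component entropy 𝔈_θ(f,g,h). -/
noncomputable def entropy3 (θ : ℝ) (f g h : ℝ → ℝ) : ℝ :=
  nsq f + nsq g + nsq h - (θ / (2 * π)) * ∫ x in (0:ℝ)..(2 * π), antider f x * g x


open Set Filter Topology

/-- **Wirtinger's inequality** for a `C¹` function with mean zero and equal endpoint values. -/
theorem integral_sq_le_integral_deriv_sq {F f : ℝ → ℝ} (hF : ∀ x, HasDerivAt F (f x) x)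
    (hf : Continuous f) (hper : F (2 * π) = F 0) (hmean : ∫ x in (0:ℝ)..(2 * π), F x = 0) :
    ∫ x in (0:ℝ)..(2 * π), F x ^ 2 ≤ ∫ x in (0:ℝ)..(2 * π), f x ^ 2 := by
  have hpi : (0:ℝ) < 2 * π := by positivity
  have hFc : Continuous F := continuous_iff_continuousAt.2 fun x => (hF x).continuousAt
  have hL2 : ∀ {k : ℝ → ℝ}, Continuous k →
      MemLp (fun x => (k x : ℂ)) 2 (volume.restrict (Ioc 0 (2 * π))) := by
    intro k hk
    obtain ⟨C, hC⟩ := (isCompact_Icc (a := (0:ℝ)) (b := 2 * π)).exists_bound_of_continuousOn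
      hk.continuousOn
    refine .of_bound (Complex.continuous_ofReal.comp hk).aestronglyMeasurable C ?_
    filter_upwards [ae_restrict_mem measurableSet_Ioc] with x hx
    simpa using hC x (Ioc_subset_Icc_self hx)
  have h₁ := hasSum_sq_fourierCoeffOn hpi (hL2 hFc)
  have h₂ := hasSum_sq_fourierCoeffOn hpi (hL2 hf)
  have key := hasSum_le (fun n => ?_) h₁ h₂
  · simp only [Complex.norm_real, Real.norm_eq_abs, sq_abs, smul_eq_mul, sub_zero] at key
    exact le_of_mul_le_mul_left key (by positivity)
  · rcases eq_or_ne n 0 with rfl | hn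
    · rw [fourierCoeffOn_eq_integral]
      simp [intervalIntegral.integral_ofReal, hmean]
    · rw [fourierCoeffOn_of_hasDerivAt hpi hn (fun x _ => (hF x).ofReal_comp)
        ((Complex.continuous_ofReal.comp hf).intervalIntegrable _ _), hper]
      have hn1 : (1:ℝ) ≤ |(n:ℝ)| := by exact_mod_cast Int.one_le_abs hn
      gcongr
      simp only [sub_self, mul_zero, zero_sub, sub_zero, Complex.ofReal_zero, norm_mul, norm_div, norm_neg, norm_one,
        Complex.norm_real, Complex.norm_I, Complex.norm_ofNat, Complex.norm_intCast,
        Complex.ofReal_mul, Complex.ofReal_ofNat, Real.norm_eq_abs, abs_of_pos pi_pos]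
      rw [mul_one, ← mul_assoc, one_div_mul_eq_div, div_mul_eq_mul_div]
      rw [div_le_iff₀ (by positivity)]
      have := norm_nonneg (fourierCoeffOn hpi (fun x => (f x : ℂ)) n)
      nlinarith [mul_nonneg pi_pos.le this, mul_nonneg (mul_nonneg pi_pos.le this) (sub_nonneg.2 hn1)]

theorem hasDerivAt_integral_of_continuousOn_deriv {G G' : ℝ → ℝ → ℝ}
    (hG : ∀ t, Continuous (G t))
    (hG' : ContinuousOn (Function.uncurry G') (Ioi 0 ×ˢ univ))
    (hd : ∀ t, 0 < t → ∀ x, HasDerivAt (fun s => G s x) (G' t x) t) (a b : ℝ) {t : ℝ}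
    (ht : 0 < t) :
    HasDerivAt (fun s => ∫ x in a..b, G s x) (∫ x in a..b, G' t x) t := by
  have hsub : Icc (t / 2) (2 * t) ×ˢ uIcc a b ⊆ Ioi (0:ℝ) ×ˢ (univ : Set ℝ) :=
    prod_mono (fun s hs => lt_of_lt_of_le (by positivity) hs.1) (subset_univ _)
  obtain ⟨C, hC⟩ := (isCompact_Icc.prod isCompact_uIcc).exists_bound_of_continuousOn
    (hG'.mono hsub)
  have hslice : Continuous (G' t) := by
    rw [← continuousOn_univ]
    exact hG'.comp (f := fun x => (t, x)) (by fun_prop) fun x _ => ⟨ht, mem_univ _⟩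
  refine (intervalIntegral.hasDerivAt_integral_of_dominated_loc_of_deriv_le (μ := volume)
    (bound := fun _ => C) (s := Icc (t / 2) (2 * t)) (Icc_mem_nhds (by linarith) (by linarith))
    (.of_forall fun s => (hG s).aestronglyMeasurable) ((hG t).intervalIntegrable _ _)
    hslice.aestronglyMeasurable (ae_of_all _ fun x hx s hs => ?_) (by simp)
    (ae_of_all _ fun x _ s hs => hd s (lt_of_lt_of_le (by positivity) hs.1) x)).2
  exact hC (s, x) ⟨hs, uIoc_subset_uIcc hx⟩

theorem hasDerivAt_antider {f : ℝ → ℝ} (hf : Continuous f) (x : ℝ) :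
    HasDerivAt (antider f) (f x) x :=
  (intervalIntegral.integral_hasDerivAt_right (hf.intervalIntegrable _ _)
    hf.aestronglyMeasurable.stronglyMeasurableAtFilter hf.continuousAt).sub_const _

theorem integral_antider {f : ℝ → ℝ} (hf : Continuous f) :
    ∫ x in (0:ℝ)..(2 * π), antider f x = 0 := by
  have hP : Continuous fun x => ∫ y in (0:ℝ)..x, f y :=
    intervalIntegral.continuous_primitive (fun _ _ => hf.intervalIntegrable _ _) _
  unfold antider
  rw [intervalIntegral.integral_sub (hP.intervalIntegrable _ _) (by simp),
    intervalIntegral.integral_const, havg, smul_eq_mul]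
  field_simp
  ring

theorem antider_two_pi {f : ℝ → ℝ} (hf : ∫ x in (0:ℝ)..(2 * π), f x = 0) :
    antider f (2 * π) = antider f 0 := by
  simp [antider, hf]

theorem continuous_antider {f : ℝ → ℝ → ℝ} (hf : Continuous (Function.uncurry f)) :
    Continuous (Function.uncurry fun t x => antider (f t) x) := by
  have hP : Continuous (fun p : ℝ × ℝ => ∫ y in (0:ℝ)..p.2, f p.1 y) :=
    intervalIntegral.continuous_parametric_primitive_of_continuous hf
  have hA : Continuous fun t : ℝ => ∫ x in (0:ℝ)..(2 * π), ∫ y in (0:ℝ)..x, f t y :=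
    intervalIntegral.continuous_parametric_intervalIntegral_of_continuous'
      (f := fun t x => ∫ y in (0:ℝ)..x, f t y) hP _ _
  unfold antider havg
  exact hP.sub ((hA.comp continuous_fst).const_mul _)

theorem hasDerivAt_antider_time {f g gx : ℝ → ℝ → ℝ} {c : ℝ}
    (hf : Continuous (Function.uncurry f)) (hg : Continuous (Function.uncurry g))
    (hgx : ContinuousOn (Function.uncurry gx) (Ioi 0 ×ˢ univ))
    (hgd : ∀ t, 0 < t → ∀ x, HasDerivAt (g t) (gx t x) x)
    (hft : ∀ t, 0 < t → ∀ x, HasDerivAt (fun s => f s x) (c * gx t x) t)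
    {t : ℝ} (ht : 0 < t) (x : ℝ) :
    HasDerivAt (fun s => antider (f s) x) (c * (g t x - havg (g t))) t := by
  have hP : ∀ s, 0 < s → ∀ x, HasDerivAt (fun s => ∫ y in (0:ℝ)..x, f s y)
      (c * (g s x - g s 0)) s := by
    intro s hs x
    have h := hasDerivAt_integral_of_continuousOn_deriv (fun t => hf.uncurry_left t)
      (G' := fun t x => c * gx t x) (continuousOn_const.mul hgx) hft 0 x hs
    have hslice : Continuous (gx s) := by
      rw [← continuousOn_univ]
      exact hgx.comp (f := fun x => (s, x)) (by fun_prop) fun x _ => ⟨hs, mem_univ _⟩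
    rwa [intervalIntegral.integral_const_mul, intervalIntegral.integral_eq_sub_of_hasDerivAt
      (fun x _ => hgd s hs x) (hslice.intervalIntegrable _ _)] at h
  have hgc : ∀ t, Continuous (g t) := fun t => hg.uncurry_left t
  have hA := hasDerivAt_integral_of_continuousOn_deriv
    (G := fun s x => ∫ y in (0:ℝ)..x, f s y) (G' := fun s x => c * (g s x - g s 0))
    (fun t => intervalIntegral.continuous_primitive
      (fun _ _ => (hf.uncurry_left t).intervalIntegrable _ _) _)
    (Continuous.continuousOn (by
      have : Continuous fun p : ℝ × ℝ => g p.1 0 := hg.comp (continuous_fst.prodMk continuous_const)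
      exact (hg.sub this).const_mul c)) hP 0 (2 * π) ht
  refine ((hP t ht x).sub (hA.const_mul (1 / (2 * π)))).congr_deriv ?_
  rw [intervalIntegral.integral_const_mul, intervalIntegral.integral_sub
    ((hgc t).intervalIntegrable _ _) (by simp), intervalIntegral.integral_const, havg, smul_eq_mul]
  field_simp
  ring

/-- The slices of a function that is `C¹` up to time zero, for positive times. -/
theorem hasDerivAt_slices {u : ℝ → ℝ → ℝ}
    (hu : ContDiffOn ℝ 1 (Function.uncurry u) (Ici (0:ℝ) ×ˢ univ)) :
    ContinuousOn (Function.uncurry fun t x => deriv (u t) x) (Ioi 0 ×ˢ univ) ∧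
    (∀ t, 0 < t → ∀ x, HasDerivAt (u t) (deriv (u t) x) x) ∧
    (∀ t, 0 < t → ∀ x, HasDerivAt (fun s => u s x) (deriv (fun s => u s x) t) t) := by
  have hopen : IsOpen (Ioi (0:ℝ) ×ˢ (univ : Set ℝ)) := isOpen_Ioi.prod isOpen_univ
  have hu' := hu.mono (prod_mono Ioi_subset_Ici_self (subset_refl univ))
  have hfd : ∀ t, 0 < t → ∀ x,
      HasFDerivAt (Function.uncurry u) (fderiv ℝ (Function.uncurry u) (t, x)) (t, x) :=
    fun t ht x => ((hu'.differentiableOn one_ne_zero).differentiableAt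
      (hopen.mem_nhds (mk_mem_prod ht (mem_univ _)))).hasFDerivAt
  have hx : ∀ t, 0 < t → ∀ x,
      HasDerivAt (u t) (fderiv ℝ (Function.uncurry u) (t, x) (0, 1)) x := fun t ht x =>
    (hfd t ht x).comp_hasDerivAt x ((hasDerivAt_const x t).prodMk (hasDerivAt_id x))
  have hτ : ∀ t, 0 < t → ∀ x,
      HasDerivAt (fun s => u s x) (fderiv ℝ (Function.uncurry u) (t, x) (1, 0)) t := fun t ht x =>
    (hfd t ht x).comp_hasDerivAt (f := fun s => (s, x)) t ((hasDerivAt_id t).prodMk (hasDerivAt_const t x))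
  refine ⟨?_, fun t h x => (hx t h x).differentiableAt.hasDerivAt,
    fun t h x => (hτ t h x).differentiableAt.hasDerivAt⟩
  refine ((hu'.continuousOn_fderiv_of_isOpen hopen le_rfl).clm_apply
    (continuousOn_const (c := ((0:ℝ), (1:ℝ))))).congr fun p hp => ?_
  exact (hx p.1 hp.1 p.2).deriv

/-- The pointwise estimate behind the entropy dissipation inequality. -/
theorem dissipation_pointwise {a b θ α m M s : ℝ} (hb : b ^ 2 = 1 / 3) (hα : 0 < α)
    (hI₁ : a * θ + α < 2 * m) (hI₂ : α ≤ a * θ) (hms : m ≤ s) (hsM : s ≤ M) (f g h F : ℝ) :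
    -2 * s * (g ^ 2 + h ^ 2) + θ * a * g ^ 2 - θ * a * f ^ 2 - θ * b * f * h + θ * s * F * g
      + α * (f ^ 2 + g ^ 2 + h ^ 2 - θ * (F * g)) ≤
    θ ^ 2 * M ^ 2 / (8 * m - 4 * a * θ - 4 * α) * F ^ 2
      + (θ ^ 2 / (12 * (2 * m - α)) - (a * θ - α)) * f ^ 2 := by
  have hd : 0 < 2 * m - a * θ - α := by linarith
  have he : 0 < 2 * m - α := by linarith
  have hFg : θ * (s - α) * (F * g) ≤ (2 * s - a * θ - α) * g ^ 2
      + θ ^ 2 * M ^ 2 / (8 * m - 4 * a * θ - 4 * α) * F ^ 2 := by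
    have h₁ : θ * (s - α) * (F * g) - (2 * m - a * θ - α) * g ^ 2 ≤
        θ ^ 2 * M ^ 2 / (8 * m - 4 * a * θ - 4 * α) * F ^ 2 := by
      rw [div_mul_eq_mul_div, le_div_iff₀ (by linarith)]
      have h₂ : (s - α) ^ 2 ≤ M ^ 2 := pow_le_pow_left₀ (by linarith) (by linarith) 2
      nlinarith [sq_nonneg (2 * (2 * m - a * θ - α) * g - θ * (s - α) * F),
        mul_le_mul_of_nonneg_left h₂ (sq_nonneg (θ * F))]
    nlinarith [mul_nonneg (sub_nonneg.2 hms) (sq_nonneg g)]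
  have hfh : -(θ * b * f * h) ≤ (2 * s - α) * h ^ 2 + θ ^ 2 / (12 * (2 * m - α)) * f ^ 2 := by
    have h₁ : -(θ * b * f * h) - (2 * m - α) * h ^ 2 ≤ θ ^ 2 / (12 * (2 * m - α)) * f ^ 2 := by
      rw [div_mul_eq_mul_div, le_div_iff₀ (by linarith)]
      have h₂ : (6 * b * (2 * m - α) * h + θ * f) ^ 2 = 12 * (2 * m - α) ^ 2 * h ^ 2
          + 12 * b * (2 * m - α) * h * θ * f + θ ^ 2 * f ^ 2 := by
        linear_combination 36 * (2 * m - α) ^ 2 * h ^ 2 * hb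
      nlinarith [sq_nonneg (6 * b * (2 * m - α) * h + θ * f)]
    nlinarith [mul_nonneg (sub_nonneg.2 hms) (sq_nonneg h)]
  linarith

/-- The entropy dissipation inequality at a fixed time. -/
theorem dissipation_integral {a b θ α m M : ℝ} {σ f g h f' g' h' : ℝ → ℝ} (ha : 0 < a)
    (hb : b ^ 2 = 1 / 3) (hθ : 0 < θ) (hα : 0 < α)
    (hI₁ : a * θ + α < 2 * m) (hI₂ : α ≤ a * θ)
    (hII : θ ^ 2 * M ^ 2 / (8 * m - 4 * a * θ - 4 * α) + θ ^ 2 / (12 * (2 * m - α)) ≤ a * θ - α)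
    (hσ : Continuous σ) (hmσ : ∀ x, m ≤ σ x) (hσM : ∀ x, σ x ≤ M)
    (hf : ∀ x, HasDerivAt f (f' x) x) (hg : ∀ x, HasDerivAt g (g' x) x)
    (hh : ∀ x, HasDerivAt h (h' x) x)
    (hf' : Continuous f') (hg' : Continuous g') (hh' : Continuous h')
    (hfp : f (2 * π) = f 0) (hgp : g (2 * π) = g 0) (hhp : h (2 * π) = h 0)
    (hf0 : ∫ x in (0:ℝ)..(2 * π), f x = 0) :
    ∫ x in (0:ℝ)..(2 * π), (2 * f x * (-a * g' x) + 2 * g x * (-a * f' x - b * h' x - σ x * g x)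
        + 2 * h x * (-b * g' x - σ x * h x) - θ * (-a * (g x - havg g) * g x
        + antider f x * (-a * f' x - b * h' x - σ x * g x))) ≤
      -α * ∫ x in (0:ℝ)..(2 * π), (f x ^ 2 + g x ^ 2 + h x ^ 2 - θ * (antider f x * g x)) := by
  have hpi : (0:ℝ) < 2 * π := by positivity
  have hfc : Continuous f := continuous_iff_continuousAt.2 fun x => (hf x).continuousAt
  have hgc : Continuous g := continuous_iff_continuousAt.2 fun x => (hg x).continuousAt
  have hhc : Continuous h := continuous_iff_continuousAt.2 fun x => (hh x).continuousAt
  have hF := hasDerivAt_antider hfc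
  have hFp := antider_two_pi hf0
  have hPW := integral_sq_le_integral_deriv_sq hF hfc hFp (integral_antider hfc)
  have hFc : Continuous (antider f) := continuous_iff_continuousAt.2 fun x => (hF x).continuousAt
  set F := antider f
  set A := θ ^ 2 * M ^ 2 / (8 * m - 4 * a * θ - 4 * α)
  set B := θ ^ 2 / (12 * (2 * m - α))
  have hA0 : 0 ≤ A := div_nonneg (by positivity) (by linarith)
  set D : ℝ → ℝ := fun x => -2 * a * (f' x * g x + f x * g' x)
    - 2 * b * (g' x * h x + g x * h' x) + θ * a * (f x * f x + F x * f' x)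
    + θ * b * (f x * h x + F x * h' x) with hD
  have hDint : ∫ x in (0:ℝ)..(2 * π), D x = 0 := by
    rw [intervalIntegral.integral_eq_sub_of_hasDerivAt
      (f := fun x => -2 * a * (f x * g x) - 2 * b * (g x * h x) + θ * a * (F x * f x)
        + θ * b * (F x * h x)) (fun x _ => ?_)
      (Continuous.intervalIntegrable (by fun_prop) _ _)]
    · simp only [hfp, hgp, hhp, hFp, sub_self]
    · exact (((((hf x).mul (hg x)).const_mul _).sub (((hg x).mul (hh x)).const_mul _)).add
        (((hF x).mul (hf x)).const_mul _)).add (((hF x).mul (hh x)).const_mul _)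
  have hDc : Continuous D := by fun_prop
  clear_value D
  have hgavg : ∫ x in (0:ℝ)..(2 * π), g x = 2 * π * havg g := by
    rw [havg]; field_simp
  rw [neg_mul, ← intervalIntegral.integral_const_mul, ← sub_nonpos, sub_neg_eq_add,
    ← intervalIntegral.integral_add (Continuous.intervalIntegrable (by fun_prop) _ _)
      (Continuous.intervalIntegrable (by fun_prop) _ _)]
  calc _ ≤ ∫ x in (0:ℝ)..(2 * π), (D x + (-(θ * a * havg g) * g x)
        + (A * F x ^ 2 + (B - (a * θ - α)) * f x ^ 2)) := by
        refine intervalIntegral.integral_mono_on hpi.le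
          (Continuous.intervalIntegrable (by fun_prop) _ _)
          (Continuous.intervalIntegrable (by fun_prop) _ _) fun x _ => ?_
        have := dissipation_pointwise hb hα hI₁ hI₂ (hmσ x) (hσM x) (f x) (g x) (h x) (F x)
        simp only [hD]
        linarith
    _ = -(θ * a * havg g) * (2 * π * havg g) + (A * (∫ x in (0:ℝ)..(2 * π), F x ^ 2)
        + (B - (a * θ - α)) * ∫ x in (0:ℝ)..(2 * π), f x ^ 2) := by
        rw [intervalIntegral.integral_add, intervalIntegral.integral_add,
          intervalIntegral.integral_add, hDint, intervalIntegral.integral_const_mul,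
          intervalIntegral.integral_const_mul, intervalIntegral.integral_const_mul, hgavg, zero_add]
        all_goals exact Continuous.intervalIntegrable (by fun_prop) _ _
    _ ≤ 0 := by
        have h₁ : 0 ≤ ∫ x in (0:ℝ)..(2 * π), f x ^ 2 :=
          intervalIntegral.integral_nonneg hpi.le fun x _ => sq_nonneg _
        have h₂ : 0 ≤ θ * a * π * havg g ^ 2 := by positivity
        nlinarith [mul_le_mul_of_nonneg_left hPW hA0, mul_nonneg (sub_nonneg.2 hII) h₁]

theorem entropy3_eq_integral {θ : ℝ} {f g h : ℝ → ℝ} (hf : Continuous f) (hg : Continuous g)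
    (hh : Continuous h) : entropy3 θ f g h = (1 / (2 * π)) *
      ∫ x in (0:ℝ)..(2 * π), (f x ^ 2 + g x ^ 2 + h x ^ 2 - θ * (antider f x * g x)) := by
  have hF : Continuous (antider f) :=
    continuous_iff_continuousAt.2 fun x => (hasDerivAt_antider hf x).continuousAt
  rw [intervalIntegral.integral_sub, intervalIntegral.integral_add, intervalIntegral.integral_add,
    intervalIntegral.integral_const_mul, entropy3, nsq, nsq, nsq]
  · ring
  all_goals exact Continuous.intervalIntegrable (by fun_prop) _ _

/-- A function satisfying the differential inequality `J' ≤ -α J` decays exponentially. -/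
theorem le_mul_exp_of_hasDerivAt_le {J J' : ℝ → ℝ} {α : ℝ} (hJ : ContinuousOn J (Ici 0))
    (hd : ∀ t, 0 < t → HasDerivAt J (J' t) t) (hle : ∀ t, 0 < t → J' t ≤ -α * J t) {t : ℝ}
    (ht : 0 ≤ t) : J t ≤ J 0 * Real.exp (-α * t) := by
  have hd' : ∀ t, 0 < t → HasDerivAt (fun t => J t * Real.exp (α * t))
      (J' t * Real.exp (α * t) + J t * (Real.exp (α * t) * α)) t := fun t ht =>
    (hd t ht).mul (by simpa using ((hasDerivAt_id t).const_mul α).exp)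
  have hanti : AntitoneOn (fun t => J t * Real.exp (α * t)) (Ici 0) := by
    refine antitoneOn_of_deriv_nonpos (convex_Ici 0) (hJ.mul (by fun_prop)) ?_ ?_ <;>
      rw [interior_Ici]
    · exact fun t ht => (hd' t ht).differentiableAt.differentiableWithinAt
    · intro t ht
      rw [(hd' t ht).deriv]
      nlinarith [mul_le_mul_of_nonneg_right (hle t ht) (Real.exp_pos (α * t)).le]
  have h := hanti self_mem_Ici ht ht
  simp only [mul_zero, Real.exp_zero, mul_one] at h
  rw [neg_mul, Real.exp_neg, ← div_eq_mul_inv]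
  exact (le_div_iff₀ (Real.exp_pos _)).2 h

/-- Entropy decay for solutions given by jointly continuous functions whose space derivatives are
jointly continuous at positive times. -/
theorem entropy3_le_mul_exp {a b θ α m M : ℝ} {σ : ℝ → ℝ} {f g h fx gx hx : ℝ → ℝ → ℝ}
    (ha : 0 < a) (hb : b ^ 2 = 1 / 3) (hθ : 0 < θ) (hα : 0 < α)
    (hI₁ : a * θ + α < 2 * m) (hI₂ : α ≤ a * θ)
    (hII : θ ^ 2 * M ^ 2 / (8 * m - 4 * a * θ - 4 * α) + θ ^ 2 / (12 * (2 * m - α)) ≤ a * θ - α)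
    (hσ : Continuous σ) (hmσ : ∀ x, m ≤ σ x) (hσM : ∀ x, σ x ≤ M)
    (hf : Continuous (Function.uncurry f)) (hg : Continuous (Function.uncurry g))
    (hh : Continuous (Function.uncurry h))
    (hfx : ContinuousOn (Function.uncurry fx) (Ioi 0 ×ˢ univ))
    (hgx : ContinuousOn (Function.uncurry gx) (Ioi 0 ×ˢ univ))
    (hhx : ContinuousOn (Function.uncurry hx) (Ioi 0 ×ˢ univ))
    (hfd : ∀ t, 0 < t → ∀ x, HasDerivAt (f t) (fx t x) x)
    (hgd : ∀ t, 0 < t → ∀ x, HasDerivAt (g t) (gx t x) x)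
    (hhd : ∀ t, 0 < t → ∀ x, HasDerivAt (h t) (hx t x) x)
    (hft : ∀ t, 0 < t → ∀ x, HasDerivAt (fun s => f s x) (-a * gx t x) t)
    (hgt : ∀ t, 0 < t → ∀ x,
      HasDerivAt (fun s => g s x) (-a * fx t x - b * hx t x - σ x * g t x) t)
    (hht : ∀ t, 0 < t → ∀ x, HasDerivAt (fun s => h s x) (-b * gx t x - σ x * h t x) t)
    (hfp : ∀ t, f t (2 * π) = f t 0) (hgp : ∀ t, g t (2 * π) = g t 0)
    (hhp : ∀ t, h t (2 * π) = h t 0)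
    (hf0 : ∫ x in (0:ℝ)..(2 * π), f 0 x = 0) {t : ℝ} (ht : 0 ≤ t) :
    entropy3 θ (f t) (g t) (h t) ≤ entropy3 θ (f 0) (g 0) (h 0) * Real.exp (-α * t) := by
  have hslice : ∀ {k : ℝ → ℝ → ℝ}, ContinuousOn (Function.uncurry k) (Ioi 0 ×ˢ univ) →
      ∀ s, 0 < s → Continuous (k s) := by
    intro k hk s hs
    rw [← continuousOn_univ]
    exact hk.comp (f := fun x => (s, x)) (by fun_prop) fun x _ => ⟨hs, mem_univ _⟩
  have hmass : ∀ s, 0 ≤ s → ∫ x in (0:ℝ)..(2 * π), f s x = 0 := by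
    have hd : ∀ s, 0 < s → HasDerivAt (fun s => ∫ x in (0:ℝ)..(2 * π), f s x) 0 s := by
      intro s hs
      refine (hasDerivAt_integral_of_continuousOn_deriv (fun t => hf.uncurry_left t)
        (G' := fun t x => -a * gx t x) (continuousOn_const.mul hgx) hft 0 (2 * π)
        hs).congr_deriv ?_
      rw [intervalIntegral.integral_const_mul, intervalIntegral.integral_eq_sub_of_hasDerivAt
        (fun x _ => hgd s hs x) ((hslice hgx s hs).intervalIntegrable _ _), hgp, sub_self, mul_zero]
    have hc : Continuous fun s : ℝ => ∫ x in (0:ℝ)..(2 * π), f s x :=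
      intervalIntegral.continuous_parametric_intervalIntegral_of_continuous' hf _ _
    intro s hs
    have h₁ := le_mul_exp_of_hasDerivAt_le (α := 0) hc.continuousOn hd (by simp) hs
    have h₂ := le_mul_exp_of_hasDerivAt_le (α := 0) hc.neg.continuousOn
      (fun s hs => (hd s hs).neg) (by simp) hs
    simp only [hf0, Pi.neg_apply, neg_zero, zero_mul] at h₁ h₂
    linarith
  have hF := continuous_antider hf
  have hFx : ContinuousOn (Function.uncurry fun t x => g t x - havg (g t)) (Ioi 0 ×ˢ univ) := by
    have hA : Continuous fun t : ℝ => ∫ x in (0:ℝ)..(2 * π), g t x :=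
      intervalIntegral.continuous_parametric_intervalIntegral_of_continuous' hg _ _
    exact (hg.sub ((hA.comp continuous_fst).const_mul _)).continuousOn
  have hFt := fun s (hs : 0 < s) x => hasDerivAt_antider_time hf hg hgx hgd hft hs x
  rw [entropy3_eq_integral (hf.uncurry_left t) (hg.uncurry_left t) (hh.uncurry_left t),
    entropy3_eq_integral (hf.uncurry_left 0) (hg.uncurry_left 0) (hh.uncurry_left 0), mul_assoc]
  refine mul_le_mul_of_nonneg_left ?_ (by positivity)
  have hint : Continuous (Function.uncurry fun t x =>
      f t x ^ 2 + g t x ^ 2 + h t x ^ 2 - θ * (antider (f t) x * g t x)) :=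
    (((hf.pow 2).add (hg.pow 2)).add (hh.pow 2)).sub ((hF.mul hg).const_mul θ)
  refine le_mul_exp_of_hasDerivAt_le
    (J := fun t => ∫ x in (0:ℝ)..(2 * π),
      (f t x ^ 2 + g t x ^ 2 + h t x ^ 2 - θ * (antider (f t) x * g t x)))
    (intervalIntegral.continuous_parametric_intervalIntegral_of_continuous' hint _ _).continuousOn
    (fun s hs => hasDerivAt_integral_of_continuousOn_deriv
      (G' := fun t x => 2 * f t x * (-a * gx t x)
        + 2 * g t x * (-a * fx t x - b * hx t x - σ x * g t x)
        + 2 * h t x * (-b * gx t x - σ x * h t x) - θ * (-a * (g t x - havg (g t)) * g t x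
        + antider (f t) x * (-a * fx t x - b * hx t x - σ x * g t x)))
      (fun t => hint.uncurry_left t) ?_ ?_ _ _ hs)
    (fun s hs => dissipation_integral ha hb hθ hα hI₁ hI₂ hII hσ hmσ hσM (hfd s hs) (hgd s hs)
      (hhd s hs) (hslice hfx s hs) (hslice hgx s hs) (hslice hhx s hs) (hfp s) (hgp s) (hhp s)
      (hmass s hs.le)) ht
  · have hf' := hf.continuousOn (s := Ioi 0 ×ˢ univ)
    have hg' := hg.continuousOn (s := Ioi 0 ×ˢ univ)
    have hh' := hh.continuousOn (s := Ioi 0 ×ˢ univ)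
    have hF' := hF.continuousOn (s := Ioi 0 ×ˢ univ)
    have hσ' : ContinuousOn (fun p : ℝ × ℝ => σ p.2) (Ioi 0 ×ˢ univ) := by fun_prop
    simp only [Function.uncurry_def] at *
    fun_prop
  · intro s hs x
    refine (((((hft s hs x).pow 2).add ((hgt s hs x).pow 2)).add ((hht s hs x).pow 2)).sub
      (((hFt s hs x).mul (hgt s hs x)).const_mul θ)).congr_deriv ?_
    norm_num

/-- Corollary 6.3 (first part): entropy decay for the 3-velocity Goldstein–Taylor model
under the simplified conditions involving σ_min and σ_max. -/
theorem gt3_entropy_decay_simple_conditions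
    (σ : ℝ → ℝ) (hσc : Continuous σ) (hσp : Function.Periodic σ (2 * π))
    (hmin : 0 < sInf (Set.range σ))
    (u₁ u₂ u₃ : ℝ → ℝ → ℝ) (u₁₀ u₂₀ u₃₀ : ℝ → ℝ)
    (h1C : ContDiffOn ℝ 1 (Function.uncurry u₁) (Set.Ici (0:ℝ) ×ˢ Set.univ))
    (h2C : ContDiffOn ℝ 1 (Function.uncurry u₂) (Set.Ici (0:ℝ) ×ˢ Set.univ))
    (h3C : ContDiffOn ℝ 1 (Function.uncurry u₃) (Set.Ici (0:ℝ) ×ˢ Set.univ))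
    (h1p : ∀ t, Function.Periodic (u₁ t) (2 * π))
    (h2p : ∀ t, Function.Periodic (u₂ t) (2 * π))
    (h3p : ∀ t, Function.Periodic (u₃ t) (2 * π))
    (hpde1 : ∀ t, 0 < t → ∀ x,
      deriv (fun s => u₁ s x) t + Real.sqrt (2 / 3) * deriv (fun y => u₂ t y) x = 0)
    (hpde2 : ∀ t, 0 < t → ∀ x,
      deriv (fun s => u₂ s x) t + Real.sqrt (2 / 3) * deriv (fun y => u₁ t y) x +
        (1 / Real.sqrt 3) * deriv (fun y => u₃ t y) x = -σ x * u₂ t x)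
    (hpde3 : ∀ t, 0 < t → ∀ x,
      deriv (fun s => u₃ s x) t + (1 / Real.sqrt 3) * deriv (fun y => u₂ t y) x
        = -σ x * u₃ t x)
    (h10 : ∀ x, u₁ 0 x = u₁₀ x) (h20 : ∀ x, u₂ 0 x = u₂₀ x) (h30 : ∀ x, u₃ 0 x = u₃₀ x)
    (θ α : ℝ) (hθ : 0 < θ) (hα : 0 < α)
    (hI₁ : Real.sqrt (2 / 3) * θ + α < 2 * sInf (Set.range σ))
    (hI₂ : α ≤ Real.sqrt (2 / 3) * θ)
    (hII : θ ^ 2 * (sSup (Set.range σ)) ^ 2 /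
          (8 * sInf (Set.range σ) - 4 * Real.sqrt (2 / 3) * θ - 4 * α) +
        θ ^ 2 / (12 * (2 * sInf (Set.range σ) - α)) ≤
          Real.sqrt (2 / 3) * θ - α) :
    ∀ t, 0 ≤ t →
      entropy3 θ (fun x => u₁ t x - havg u₁₀) (u₂ t) (u₃ t) ≤
        entropy3 θ (fun x => u₁₀ x - havg u₁₀) u₂₀ u₃₀ * Real.exp (-α * t) := by
  have hpi : (0:ℝ) < 2 * π := by positivity
  have hcpt : IsCompact (range σ) := by
    rw [← hσp.image_Icc hpi 0]
    exact isCompact_Icc.image hσc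
  obtain ⟨hc₁, hx₁, ht₁⟩ := hasDerivAt_slices h1C
  obtain ⟨hc₂, hx₂, ht₂⟩ := hasDerivAt_slices h2C
  obtain ⟨hc₃, hx₃, ht₃⟩ := hasDerivAt_slices h3C
  have hext : ∀ {u : ℝ → ℝ → ℝ}, ContDiffOn ℝ 1 (Function.uncurry u) (Ici (0:ℝ) ×ˢ univ) →
      Continuous (Function.uncurry fun t x => u (max t 0) x) := fun {u} hu => by
    rw [← continuousOn_univ]
    exact hu.continuousOn.comp (f := fun p : ℝ × ℝ => (max p.1 0, p.2)) (by fun_prop)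
      fun p _ => mk_mem_prod (le_max_right p.1 0) (mem_univ _)
  have hev : ∀ {t : ℝ}, 0 < t → ∀ (u : ℝ → ℝ → ℝ) (x : ℝ),
      (fun s => u (max s 0) x) =ᶠ[𝓝 t] fun s => u s x := fun {t} ht u x => by
    filter_upwards [lt_mem_nhds ht] with s hs
    rw [max_eq_left hs.le]
  have hu₁₀ : u₁₀ = u₁ 0 := funext fun x => (h10 x).symm
  have hu₂₀ : u₂₀ = u₂ 0 := funext fun x => (h20 x).symm
  have hu₃₀ : u₃₀ = u₃ 0 := funext fun x => (h30 x).symm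
  subst hu₁₀ hu₂₀ hu₃₀
  intro t ht
  have key := entropy3_le_mul_exp (a := √(2 / 3)) (b := 1 / √3)
    (f := fun t x => u₁ (max t 0) x - havg (u₁ 0)) (g := fun t x => u₂ (max t 0) x)
    (h := fun t x => u₃ (max t 0) x) (fx := fun t x => deriv (u₁ t) x)
    (gx := fun t x => deriv (u₂ t) x) (hx := fun t x => deriv (u₃ t) x)
    (by positivity) (by rw [div_pow, Real.sq_sqrt (by norm_num)]; norm_num) hθ hα hI₁ hI₂ hII hσc
    (fun x => csInf_le hcpt.bddBelow (mem_range_self x))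
    (fun x => le_csSup hcpt.bddAbove (mem_range_self x))
    ((hext h1C).sub continuous_const) (hext h2C) (hext h3C) hc₁ hc₂ hc₃
    (fun s hs x => by simpa only [max_eq_left hs.le] using (hx₁ s hs x).sub_const _)
    (fun s hs x => by simpa only [max_eq_left hs.le] using hx₂ s hs x)
    (fun s hs x => by simpa only [max_eq_left hs.le] using hx₃ s hs x)
    (fun s hs x => (((ht₁ s hs x).congr_of_eventuallyEq (hev hs u₁ x)).sub_const _).congr_deriv
      (by linarith [hpde1 s hs x]))
    (fun s hs x => ((ht₂ s hs x).congr_of_eventuallyEq (hev hs u₂ x)).congr_deriv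
      (by simp only [max_eq_left hs.le]; linarith [hpde2 s hs x]))
    (fun s hs x => ((ht₃ s hs x).congr_of_eventuallyEq (hev hs u₃ x)).congr_deriv
      (by simp only [max_eq_left hs.le]; linarith [hpde3 s hs x]))
    (fun s => by simpa using h1p (max s 0) 0) (fun s => by simpa using h2p (max s 0) 0)
    (fun s => by simpa using h3p (max s 0) 0) ?_ ht
  · simpa only [max_eq_left ht, max_self] using key
  · have hc : Continuous (u₁ 0) := by simpa using (hext h1C).uncurry_left 0
    simp only [max_self]
    rw [intervalIntegral.integral_sub (hc.intervalIntegrable _ _) (by simp),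
      intervalIntegral.integral_const, havg, smul_eq_mul]
    field_simp
    ring
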